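/- arXiv:2210.02070 — 2 statements merged into one kernel-verified Lean document; each statement's English description precedes it below -/
import Mathlib

section
/- Fix α > 0, β₁, β₂ ∈ (0,1) and c > 0, and assume det( D(T̄₀ ∘ T̄₀)(x̃₁) − I₃ ) ≠ 0 (equivalently, 2 + β₁³·α·c + (3·β₂·α·c − 2·α·c − 2·β₂)·β₁² + 3·(β₂−1)·(α·c − 2·β₂)·β₁ ≠ 0). Then the 2-limit-cycle persists for small ε: there exist δ > 0 and a continuously differentiable curve x : (−δ, δ) → ℝ³ with x(0) = x̃₁ such that for every ε ∈ (−δ, δ) the point x(ε) satisfies T̄_ε(T̄_ε(x(ε))) = x(ε), and (after shrinking δ if necessary) x(ε) ≠ T̄_ε(x(ε)), so x(ε) is a genuine period-2 point of the autonomous Adam map with hyperparameter ε. -/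
/-- The autonomous Adam map (without bias correction) with hyperparameter `ε`
for `f(w) = (1/2)·c·w²`, on states `x = (m, v, w) ∈ ℝ³`. -/
noncomputable def adamF (α β₁ β₂ c ε : ℝ) (x : Fin 3 → ℝ) : Fin 3 → ℝ :=
  ![β₁ * x 0 + (1 - β₁) * c * x 2,
    β₂ * x 1 + (1 - β₂) * c ^ 2 * (x 2) ^ 2,
    x 2 - α * (β₁ * x 0 + (1 - β₁) * c * x 2) /
      Real.sqrt (β₂ * x 1 + (1 - β₂) * c ^ 2 * (x 2) ^ 2 + ε)]

/-- The 2-cycle point `x̃₁ = (m̃, ṽ, w̃)` for `ε = 0`. -/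
noncomputable def xF₁ (α β₁ c : ℝ) : Fin 3 → ℝ :=
  ![α * c * (1 - β₁) ^ 2 / (2 * (1 + β₁) ^ 2),
    α ^ 2 * c ^ 2 * (1 - β₁) ^ 2 / (4 * (1 + β₁) ^ 2),
    -(α * (1 - β₁)) / (2 * (1 + β₁))]

/-- The Jacobian matrix of `T̄_ε ∘ T̄_ε` at a point `p`. -/
noncomputable def adamTwoStepJacobian (α β₁ β₂ c ε : ℝ) (p : Fin 3 → ℝ) :
    Matrix (Fin 3) (Fin 3) ℝ :=
  LinearMap.toMatrix'
    (fderiv ℝ (fun y => adamF α β₁ β₂ c ε (adamF α β₁ β₂ c ε y)) p).toLinearMap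

theorem xF₁_one_pos {α β₁ c : ℝ} (hα : 0 < α) (hβ₁ : β₁ ∈ Set.Ioo (0 : ℝ) 1) (hc : 0 < c) :
    0 < xF₁ α β₁ c 1 := by
  obtain ⟨h0, h1⟩ := hβ₁
  have : 0 < 1 - β₁ := sub_pos.2 h1
  simp only [xF₁, Matrix.cons_val]
  positivity

theorem xF₁_two_neg {α β₁ c : ℝ} (hα : 0 < α) (hβ₁ : β₁ ∈ Set.Ioo (0 : ℝ) 1) :
    xF₁ α β₁ c 2 < 0 := by
  obtain ⟨h0, h1⟩ := hβ₁
  have : 0 < 1 - β₁ := sub_pos.2 h1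
  simp only [xF₁, Matrix.cons_val]
  exact div_neg_of_neg_of_pos (neg_neg_of_pos (by positivity)) (by positivity)

theorem xF₁_second_moment {α β₁ c : ℝ} (β₂ : ℝ) (hβ₁ : β₁ ∈ Set.Ioo (0 : ℝ) 1) :
    β₂ * xF₁ α β₁ c 1 + (1 - β₂) * c ^ 2 * xF₁ α β₁ c 2 ^ 2 = xF₁ α β₁ c 1 := by
  have : 1 + β₁ ≠ 0 := by linarith [hβ₁.1]
  simp only [xF₁, Matrix.cons_val]
  field_simp
  ring

theorem sqrt_xF₁_one {α β₁ c : ℝ} (hα : 0 < α) (hβ₁ : β₁ ∈ Set.Ioo (0 : ℝ) 1) (hc : 0 < c) :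
    Real.sqrt (xF₁ α β₁ c 1) = α * c * (1 - β₁) / (2 * (1 + β₁)) := by
  obtain ⟨h0, h1⟩ := hβ₁
  have : 0 < 1 - β₁ := sub_pos.2 h1
  rw [Real.sqrt_eq_iff_mul_self_eq_of_pos (by positivity)]
  simp only [xF₁, Matrix.cons_val]
  field_simp
  ring

/-- The unperturbed map sends the cycle point `(m̃, ṽ, w̃)` to `(-m̃, ṽ, -w̃)`. -/
theorem adamF_zero_xF₁ {α β₁ c : ℝ} (β₂ : ℝ) (hα : 0 < α) (hβ₁ : β₁ ∈ Set.Ioo (0 : ℝ) 1)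
    (hc : 0 < c) :
    adamF α β₁ β₂ c 0 (xF₁ α β₁ c) =
      ![-xF₁ α β₁ c 0, xF₁ α β₁ c 1, -xF₁ α β₁ c 2] := by
  have h1 : 1 - β₁ ≠ 0 := by linarith [hβ₁.2]
  have h2 : 1 + β₁ ≠ 0 := by linarith [hβ₁.1]
  rw [adamF, add_zero, xF₁_second_moment β₂ hβ₁, sqrt_xF₁_one hα hβ₁ hc]
  ext i
  fin_cases i
  · simp [xF₁]
    field_simp
    ring
  · simp
  · simp [xF₁]
    field_simp
    ring

theorem adamF_neg (α β₁ β₂ c ε m v w : ℝ) :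
    adamF α β₁ β₂ c ε ![-m, v, -w] =
      ![-adamF α β₁ β₂ c ε ![m, v, w] 0, adamF α β₁ β₂ c ε ![m, v, w] 1,
        -adamF α β₁ β₂ c ε ![m, v, w] 2] := by
  ext i
  fin_cases i
  · simp [adamF]
    ring
  · simp [adamF]
  · simp [adamF]
    ring

theorem adamF_adamF_zero_xF₁ {α β₁ c : ℝ} (β₂ : ℝ) (hα : 0 < α)
    (hβ₁ : β₁ ∈ Set.Ioo (0 : ℝ) 1) (hc : 0 < c) :
    adamF α β₁ β₂ c 0 (adamF α β₁ β₂ c 0 (xF₁ α β₁ c)) = xF₁ α β₁ c := by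
  have h : ![xF₁ α β₁ c 0, xF₁ α β₁ c 1, xF₁ α β₁ c 2] = xF₁ α β₁ c := by simp [xF₁]
  rw [adamF_zero_xF₁ β₂ hα hβ₁ hc, adamF_neg, h, adamF_zero_xF₁ β₂ hα hβ₁ hc]
  simpa using h

theorem contDiffAt_adamF (α β₁ β₂ c : ℝ) {n : WithTop ℕ∞} {p : ℝ × (Fin 3 → ℝ)}
    (hp : 0 < β₂ * p.2 1 + (1 - β₂) * c ^ 2 * p.2 2 ^ 2 + p.1) :
    ContDiffAt ℝ n (fun q : ℝ × (Fin 3 → ℝ) => adamF α β₁ β₂ c q.1 q.2) p := by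
  have hx (i : Fin 3) : ContDiffAt ℝ n (fun q : ℝ × (Fin 3 → ℝ) => q.2 i) p :=
    contDiffAt_pi.1 contDiffAt_snd i
  rw [contDiffAt_pi]
  intro i
  fin_cases i
  · simp only [adamF, Fin.zero_eta, Matrix.cons_val]
    fun_prop
  · simp only [adamF, Fin.mk_one, Matrix.cons_val]
    fun_prop
  · simp only [adamF, Fin.reduceFinMk, Matrix.cons_val]
    refine (hx 2).sub (ContDiffAt.div (by fun_prop) (ContDiffAt.sqrt (by fun_prop) hp.ne')
      (Real.sqrt_pos.2 hp).ne')

theorem contDiffAt_adamF_adamF {α β₁ c : ℝ} (β₂ : ℝ) {n : WithTop ℕ∞} (hα : 0 < α)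
    (hβ₁ : β₁ ∈ Set.Ioo (0 : ℝ) 1) (hc : 0 < c) :
    ContDiffAt ℝ n
      (fun q : ℝ × (Fin 3 → ℝ) => adamF α β₁ β₂ c q.1 (adamF α β₁ β₂ c q.1 q.2))
      (0, xF₁ α β₁ c) := by
  have hv : 0 < β₂ * xF₁ α β₁ c 1 + (1 - β₂) * c ^ 2 * xF₁ α β₁ c 2 ^ 2 + 0 := by
    rw [add_zero, xF₁_second_moment β₂ hβ₁]
    exact xF₁_one_pos hα hβ₁ hc
  refine ContDiffAt.comp (0, xF₁ α β₁ c)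
    (g := fun q : ℝ × (Fin 3 → ℝ) => adamF α β₁ β₂ c q.1 q.2)
    (f := fun q : ℝ × (Fin 3 → ℝ) => (q.1, adamF α β₁ β₂ c q.1 q.2))
    (contDiffAt_adamF α β₁ β₂ c ?_) (contDiffAt_fst.prodMk (contDiffAt_adamF α β₁ β₂ c hv))
  simpa [adamF_zero_xF₁ β₂ hα hβ₁ hc] using hv

theorem ContinuousLinearMap.isInvertible_sub_id_of_det_ne_zero {ι : Type*} [Fintype ι]
    [DecidableEq ι] {L : (ι → ℝ) →L[ℝ] (ι → ℝ)}
    (h : (LinearMap.toMatrix' L.toLinearMap - 1).det ≠ 0) :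
    (L - ContinuousLinearMap.id ℝ (ι → ℝ)).IsInvertible := by
  have hdet : LinearMap.det (L - ContinuousLinearMap.id ℝ (ι → ℝ)).toLinearMap ≠ 0 := by
    rwa [← LinearMap.det_toMatrix', ContinuousLinearMap.toLinearMap_sub, map_sub,
      ContinuousLinearMap.coe_id, LinearMap.toMatrix'_id]
  exact ⟨(LinearEquiv.ofIsUnitDet (f := (L - ContinuousLinearMap.id ℝ (ι → ℝ)).toLinearMap)
    (v := Pi.basisFun ℝ ι) (v' := Pi.basisFun ℝ ι)
    (by rw [LinearMap.det_toMatrix]; exact hdet.isUnit)).toContinuousLinearEquiv, by ext; rfl⟩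

/-- A fixed point at which the linearisation minus the identity is invertible continues to a
`C¹` curve of fixed points when the map depends on a real parameter. -/
theorem exists_contDiffAt_fixedPoint_curve {E : Type*} [NormedAddCommGroup E] [NormedSpace ℝ E]
    [CompleteSpace E] {G : ℝ × E → E} {t : ℝ} {p : E} (hG : ContDiffAt ℝ 1 G (t, p))
    (hp : G (t, p) = p)
    (hinv : (fderiv ℝ (fun y => G (t, y)) p - ContinuousLinearMap.id ℝ E).IsInvertible) :
    ∃ x : ℝ → E, ContDiffAt ℝ 1 x t ∧ x t = p ∧ ∀ᶠ s in nhds t, G (s, x s) = x s := by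
  have hF : ContDiffAt ℝ 1 (fun q : ℝ × E => G q - q.2) (t, p) := hG.sub contDiffAt_snd
  have hGd : DifferentiableAt ℝ G (t, p) := hG.differentiableAt one_ne_zero
  have hpartial : fderiv ℝ (fun q : ℝ × E => G q - q.2) (t, p) ∘L .inr ℝ ℝ E =
      fderiv ℝ (fun y => G (t, y)) p - ContinuousLinearMap.id ℝ E := by
    have h₁ := hGd.hasFDerivAt.comp p (hasFDerivAt_prodMk_right t p)
    have h₂ := (hF.differentiableAt one_ne_zero).hasFDerivAt.comp p (hasFDerivAt_prodMk_right t p)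
    have h₃ : HasFDerivAt (fun y => G (t, y)) _ p := h₁
    rw [h₃.fderiv]
    exact h₂.unique (h₁.sub (hasFDerivAt_id p))
  have hinv' : (fderiv ℝ (fun q : ℝ × E => G q - q.2) (t, p) ∘L .inr ℝ ℝ E).IsInvertible := by
    rwa [hpartial]
  refine ⟨hF.implicitFunction one_ne_zero hinv',
    hF.contDiffAt_implicitFunction one_ne_zero hinv',
    hF.implicitFunction_apply_self one_ne_zero hinv', ?_⟩
  filter_upwards [hF.eventually_apply_implicitFunction one_ne_zero hinv'] with s hs
  simpa [hp, sub_eq_zero] using hs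

theorem exists_Ioo_neg_subset_of_mem_nhds_zero {s : Set ℝ} (hs : s ∈ nhds (0 : ℝ)) :
    ∃ δ > 0, Set.Ioo (-δ) δ ⊆ s := by
  obtain ⟨δ, hδ, h⟩ := Metric.mem_nhds_iff.1 hs
  exact ⟨δ, hδ, by simpa [Real.ball_eq_Ioo] using h⟩

/-- Persistence of the 2-limit-cycle for small `ε` via the implicit function
theorem: if `det(D(T̄₀ ∘ T̄₀)(x̃₁) − I₃) ≠ 0`, there is a `C¹` curve `ε ↦ x(ε)` of
period-2 points of `T̄_ε` through `x̃₁`, and after shrinking the interval the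
points `x(ε)` are genuine period-2 points, i.e. not fixed points of `T̄_ε`. -/
theorem adam_two_cycle_persists_for_small_eps (α β₁ β₂ c : ℝ) (hα : 0 < α)
    (hβ₁ : β₁ ∈ Set.Ioo (0 : ℝ) 1) (hβ₂ : β₂ ∈ Set.Ioo (0 : ℝ) 1) (hc : 0 < c)
    (hdet : (adamTwoStepJacobian α β₁ β₂ c 0 (xF₁ α β₁ c) - 1).det ≠ 0) :
    ∃ δ > (0 : ℝ), ∃ x : ℝ → Fin 3 → ℝ,
      ContDiffOn ℝ 1 x (Set.Ioo (-δ) δ) ∧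
      x 0 = xF₁ α β₁ c ∧
      (∀ ε ∈ Set.Ioo (-δ) δ, adamF α β₁ β₂ c ε (adamF α β₁ β₂ c ε (x ε)) = x ε) ∧
      ∃ δ' ∈ Set.Ioc (0 : ℝ) δ,
        ∀ ε ∈ Set.Ioo (-δ') δ', x ε ≠ adamF α β₁ β₂ c ε (x ε) := by
  have hp := adamF_adamF_zero_xF₁ β₂ hα hβ₁ hc
  obtain ⟨x, hx, hx0, hfix⟩ := exists_contDiffAt_fixedPoint_curve
    (contDiffAt_adamF_adamF β₂ hα hβ₁ hc) hp
    (ContinuousLinearMap.isInvertible_sub_id_of_det_ne_zero hdet)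
  have hne : ∀ᶠ ε in nhds (0 : ℝ), x ε ≠ adamF α β₁ β₂ c ε (x ε) := by
    have hT : ContinuousAt (fun ε => adamF α β₁ β₂ c ε (x ε)) 0 := by
      refine ContinuousAt.comp (g := fun q : ℝ × (Fin 3 → ℝ) => adamF α β₁ β₂ c q.1 q.2)
        (f := fun ε => (ε, x ε))
        (contDiffAt_adamF α β₁ β₂ c (n := 0) ?_).continuousAt
        (continuousAt_id.prodMk hx.continuousAt)
      simpa [hx0, xF₁_second_moment β₂ hβ₁] using xF₁_one_pos hα hβ₁ hc
    refine (hx.continuousAt.ne_iff_eventually_ne hT).1 ?_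
    rw [hx0, adamF_zero_xF₁ β₂ hα hβ₁ hc]
    intro h
    have h2 := congrFun h 2
    simp only [Matrix.cons_val] at h2
    linarith [xF₁_two_neg (c := c) hα hβ₁]
  obtain ⟨δ, hδ, h⟩ := exists_Ioo_neg_subset_of_mem_nhds_zero
    ((hx.eventually (by simp)).and (hfix.and hne))
  exact ⟨δ, hδ, x, fun ε hε => (h hε).1.contDiffWithinAt, hx0, fun ε hε => (h hε).2.1,
    δ, ⟨hδ, le_rfl⟩, fun ε hε => (h hε).2.2⟩
end

section
/- Attractivity of the 2-limit-cycle persists for small ε: under the hypotheses and with the curve ε ↦ x(ε) of period-2 points of T̄_ε obtained from the implicit function theorem (x(0) = x̃₁, T̄_ε(T̄_ε(x(ε))) = x(ε)), if in addition the spectral radius of D(T̄₀ ∘ T̄₀)(x̃₁) is strictly less than 1, then there exists δ' > 0 such that for all ε ∈ (−δ', δ') the spectral radius of D(T̄_ε ∘ T̄_ε)(x(ε)) is strictly less than 1; in particular the period-2 point x(ε) is exponentially attracting for the iteration of T̄_ε ∘ T̄_ε. -/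
/-- The spectral radius of a real 3×3 matrix: the supremum of the absolute values
of its complex eigenvalues. -/
noncomputable def matrixSpectralRadius (M : Matrix (Fin 3) (Fin 3) ℝ) : ENNReal :=
  spectralRadius ℂ (M.map (algebraMap ℝ ℂ))

open scoped Matrix.Norms.Operator in
/-- The matrix of an endomorphism of `ℝ³` has spectral radius `< 1` if and only if some positive
power of the endomorphism is a strict contraction. -/
theorem matrixSpectralRadius_toMatrix'_lt_one_iff (A : (Fin 3 → ℝ) →L[ℝ] (Fin 3 → ℝ)) :
    matrixSpectralRadius (LinearMap.toMatrix' A.toLinearMap) < 1 ↔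
      ∃ n : ℕ, ‖A ^ (n + 1)‖ < 1 := by
  have key (n : ℕ) :
      ‖((LinearMap.toMatrix' A.toLinearMap).map (algebraMap ℝ ℂ)) ^ n‖ = ‖A ^ n‖ := by
    rw [← Matrix.linfty_opNorm_toMatrix (A ^ n), ← Matrix.map_pow,
      ContinuousLinearMap.toLinearMap_pow,
      show LinearMap.toMatrix' (A.toLinearMap ^ n) = LinearMap.toMatrix' A.toLinearMap ^ n from
        map_pow LinearMap.toMatrixAlgEquiv' A.toLinearMap n]
    simp [Matrix.linfty_opNorm_def]
  have key' (n : ℕ) :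
      (‖((LinearMap.toMatrix' A.toLinearMap).map (algebraMap ℝ ℂ)) ^ n‖₊ : ENNReal) < 1 ↔
        ‖A ^ n‖ < 1 := by
    rw [← key n, ← coe_nnnorm]
    norm_cast
  unfold matrixSpectralRadius
  constructor
  · intro h
    have hlim := spectrum.pow_nnnorm_pow_one_div_tendsto_nhds_spectralRadius
      ((LinearMap.toMatrix' A.toLinearMap).map (algebraMap ℝ ℂ))
    obtain ⟨n, hn, hn0⟩ :=
      ((hlim.eventually_lt_const h).and (Filter.eventually_gt_atTop 0)).exists
    refine ⟨n - 1, ?_⟩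
    rw [Nat.sub_add_cancel hn0, ← key' n]
    by_contra! hge
    exact absurd hn (not_lt.2 (ENNReal.one_le_rpow hge (by positivity)))
  · rintro ⟨n, hn⟩
    refine (spectrum.spectralRadius_le_pow_nnnorm_pow_one_div ℂ _ n).trans_lt ?_
    have h1 : (‖(1 : Matrix (Fin 3) (Fin 3) ℂ)‖₊ : ENNReal) = 1 := by simp
    rw [h1, ENNReal.one_rpow, mul_one]
    exact ENNReal.rpow_lt_one ((key' (n + 1)).2 hn) (by positivity)

/-- A fixed point at which some positive power of the derivative is a strict contraction is
exponentially attracting. -/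
theorem HasFDerivAt.exists_norm_iterate_sub_le {E : Type*} [NormedAddCommGroup E]
    [NormedSpace ℝ E] {f : E → E} {A : E →L[ℝ] E} {p : E} (hf : HasFDerivAt f A p)
    (hp : f p = p) {n : ℕ} (hn : ‖A ^ (n + 1)‖ < 1) :
    ∃ r > (0 : ℝ), ∃ C ≥ (0 : ℝ), ∃ γ ∈ Set.Ioo (0 : ℝ) 1,
      ∀ y : E, ‖y - p‖ < r → ∀ k : ℕ, ‖f^[k] y - p‖ ≤ C * γ ^ k * ‖y - p‖ := by
  obtain ⟨q, hAq, hq1⟩ := exists_between hn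
  have hq0 : 0 < q := (norm_nonneg _).trans_lt hAq
  have hfix (j : ℕ) : f^[j] p = p := Function.iterate_fixed hp j
  have hbound (j : ℕ) (B : ℝ) (hB : ‖A ^ j‖ < B) :
      ∀ᶠ y in nhds p, ‖f^[j] y - p‖ ≤ B * ‖y - p‖ := by
    have h := (hf.iterate hp j).isLittleO.def (sub_pos.2 hB)
    filter_upwards [h] with y hy
    rw [hfix j] at hy
    calc ‖f^[j] y - p‖ = ‖(f^[j] y - p - (A ^ j) (y - p)) + (A ^ j) (y - p)‖ := by
          rw [sub_add_cancel]
      _ ≤ (B - ‖A ^ j‖) * ‖y - p‖ + ‖A ^ j‖ * ‖y - p‖ :=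
          norm_add_le_of_le hy ((A ^ j).le_opNorm _)
      _ = B * ‖y - p‖ := by ring
  obtain ⟨L, hL0, hL⟩ : ∃ L > (0 : ℝ), ∀ j ∈ Finset.range (n + 1), ‖A ^ j‖ < L := by
    refine ⟨∑ j ∈ Finset.range (n + 1), ‖A ^ j‖ + 1, by positivity, fun j hj => ?_⟩
    have := Finset.single_le_sum (f := fun j => ‖A ^ j‖) (fun i _ => norm_nonneg _) hj
    exact lt_add_of_le_of_pos this one_pos
  have hall : ∀ᶠ y in nhds p, ‖f^[n + 1] y - p‖ ≤ q * ‖y - p‖ ∧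
      ∀ j ∈ Finset.range (n + 1), ‖f^[j] y - p‖ ≤ L * ‖y - p‖ :=
    (hbound (n + 1) q hAq).and
      ((Filter.eventually_all_finset _).2 fun j hj => hbound j L (hL j hj))
  obtain ⟨r, hr, hball⟩ := Metric.eventually_nhds_iff.1 hall
  simp only [dist_eq_norm] at hball
  have hmain (y : E) (hy : ‖y - p‖ < r) (a : ℕ) :
      ‖f^[(n + 1) * a] y - p‖ ≤ q ^ a * ‖y - p‖ := by
    induction a with
    | zero => simp
    | succ a ih =>
      have hlt : ‖f^[(n + 1) * a] y - p‖ < r :=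
        (ih.trans (mul_le_of_le_one_left (norm_nonneg _) (pow_le_one₀ hq0.le hq1.le))).trans_lt hy
      rw [Nat.mul_succ, Nat.add_comm, Function.iterate_add_apply, pow_succ', mul_assoc]
      exact (hball hlt).1.trans (mul_le_mul_of_nonneg_left ih hq0.le)
  set γ : ℝ := q ^ ((n + 1 : ℕ) : ℝ)⁻¹ with hγ
  have hγ0 : 0 < γ := Real.rpow_pos_of_pos hq0 _
  have hγ1 : γ < 1 := Real.rpow_lt_one hq0.le hq1 (by positivity)
  have hγn : γ ^ (n + 1) = q := Real.rpow_inv_natCast_pow hq0.le n.succ_ne_zero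
  refine ⟨r, hr, L / q, by positivity, γ, ⟨hγ0, hγ1⟩, fun y hy k => ?_⟩
  have hlt : ‖f^[(n + 1) * (k / (n + 1))] y - p‖ < r :=
    ((hmain y hy _).trans
      (mul_le_of_le_one_left (norm_nonneg _) (pow_le_one₀ hq0.le hq1.le))).trans_lt hy
  have hmod : k % (n + 1) < n + 1 := Nat.mod_lt _ n.succ_pos
  have hγmod : q ≤ γ ^ (k % (n + 1)) := hγn ▸ pow_le_pow_of_le_one hγ0.le hγ1.le hmod.le
  calc ‖f^[k] y - p‖
      = ‖f^[k % (n + 1)] (f^[(n + 1) * (k / (n + 1))] y) - p‖ := by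
        rw [← Function.iterate_add_apply, Nat.mod_add_div]
    _ ≤ L * ‖f^[(n + 1) * (k / (n + 1))] y - p‖ := (hball hlt).2 _ (Finset.mem_range.2 hmod)
    _ ≤ L * (q ^ (k / (n + 1)) * ‖y - p‖) := mul_le_mul_of_nonneg_left (hmain y hy _) hL0.le
    _ = L / q * (q * q ^ (k / (n + 1))) * ‖y - p‖ := by field_simp
    _ ≤ L / q * (γ ^ (k % (n + 1)) * q ^ (k / (n + 1))) * ‖y - p‖ := by gcongr
    _ = L / q * γ ^ k * ‖y - p‖ := by
        rw [← hγn, ← pow_mul, ← pow_add, Nat.mod_add_div]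

/-- The Adam map is jointly smooth in `(ε, x)` wherever the argument of its square root is
positive. -/
theorem contDiffAt_adamF_s8 (α β₁ β₂ c : ℝ) {e : ℝ} {p : Fin 3 → ℝ}
    (h : 0 < β₂ * p 1 + (1 - β₂) * c ^ 2 * (p 2) ^ 2 + e) :
    ContDiffAt ℝ 1 (fun z : ℝ × (Fin 3 → ℝ) => adamF α β₁ β₂ c z.1 z.2) (e, p) := by
  have hz (i : Fin 3) : ContDiffAt ℝ 1 (fun z : ℝ × (Fin 3 → ℝ) => z.2 i) (e, p) := by fun_prop
  have hm : ContDiffAt ℝ 1 (fun z : ℝ × (Fin 3 → ℝ) =>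
      β₁ * z.2 0 + (1 - β₁) * c * z.2 2) (e, p) := by fun_prop
  have hv : ContDiffAt ℝ 1 (fun z : ℝ × (Fin 3 → ℝ) =>
      β₂ * z.2 1 + (1 - β₂) * c ^ 2 * (z.2 2) ^ 2) (e, p) := by fun_prop
  rw [contDiffAt_pi]
  intro i
  fin_cases i
  · exact hm
  · exact hv
  · exact (hz 2).sub ((contDiffAt_const.mul hm).div ((hv.add contDiffAt_fst).sqrt h.ne')
      (Real.sqrt_pos.2 h).ne')

theorem contDiffAt_adamF_adamF_xF₁ {α β₁ β₂ c : ℝ} (hα : 0 < α)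
    (hβ₁ : β₁ ∈ Set.Ioo (0 : ℝ) 1) (hβ₂ : β₂ ∈ Set.Ioo (0 : ℝ) 1) (hc : 0 < c) :
    ContDiffAt ℝ 1 (fun z : ℝ × (Fin 3 → ℝ) =>
      adamF α β₁ β₂ c z.1 (adamF α β₁ β₂ c z.1 z.2)) (0, xF₁ α β₁ c) := by
  obtain ⟨hβ₁0, hβ₁1⟩ := hβ₁
  obtain ⟨hβ₂0, hβ₂1⟩ := hβ₂
  have h1 : 0 < 1 - β₁ := sub_pos.2 hβ₁1
  have h2 : 0 < 1 - β₂ := sub_pos.2 hβ₂1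
  have hv : 0 < xF₁ α β₁ c 1 := by
    simp only [xF₁, Matrix.cons_val]
    positivity
  have hv' : 0 < β₂ * xF₁ α β₁ c 1 + (1 - β₂) * c ^ 2 * (xF₁ α β₁ c 2) ^ 2 := by positivity
  have hv'' : 0 < β₂ * adamF α β₁ β₂ c 0 (xF₁ α β₁ c) 1 +
      (1 - β₂) * c ^ 2 * (adamF α β₁ β₂ c 0 (xF₁ α β₁ c) 2) ^ 2 + 0 := by
    have : 0 < adamF α β₁ β₂ c 0 (xF₁ α β₁ c) 1 := hv'
    positivity
  have hF := contDiffAt_adamF_s8 α β₁ β₂ c (e := 0) (by simpa using hv')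
  exact ContDiffAt.comp (0, xF₁ α β₁ c) (contDiffAt_adamF_s8 α β₁ β₂ c hv'')
    (contDiffAt_fst.prodMk hF)

/-- Attractivity of the 2-limit-cycle persists for small `ε`: along the implicit
function theorem curve `ε ↦ x(ε)` of period-2 points of `T̄_ε`, if the spectral
radius of `D(T̄₀ ∘ T̄₀)(x̃₁)` is `< 1`, then for all small `ε` the spectral radius of
`D(T̄_ε ∘ T̄_ε)(x(ε))` is `< 1`; in particular `x(ε)` is exponentially attracting
for the iteration of `T̄_ε ∘ T̄_ε`. -/
theorem adam_two_cycle_attractivity_persists (α β₁ β₂ c : ℝ) (hα : 0 < α)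
    (hβ₁ : β₁ ∈ Set.Ioo (0 : ℝ) 1) (hβ₂ : β₂ ∈ Set.Ioo (0 : ℝ) 1) (hc : 0 < c)
    (δ : ℝ) (hδ : 0 < δ) (x : ℝ → Fin 3 → ℝ)
    (hxC1 : ContDiffOn ℝ 1 x (Set.Ioo (-δ) δ))
    (hx0 : x 0 = xF₁ α β₁ c)
    (hper : ∀ ε ∈ Set.Ioo (-δ) δ, adamF α β₁ β₂ c ε (adamF α β₁ β₂ c ε (x ε)) = x ε)
    (hsr : matrixSpectralRadius (adamTwoStepJacobian α β₁ β₂ c 0 (xF₁ α β₁ c)) < 1) :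
    ∃ δ' > (0 : ℝ), ∀ ε ∈ Set.Ioo (-δ') δ',
      matrixSpectralRadius (adamTwoStepJacobian α β₁ β₂ c ε (x ε)) < 1 ∧
      ∃ r > (0 : ℝ), ∃ C ≥ (0 : ℝ), ∃ γ ∈ Set.Ioo (0 : ℝ) 1,
        ∀ y : Fin 3 → ℝ, ‖y - x ε‖ < r → ∀ k : ℕ,
          ‖(fun z => adamF α β₁ β₂ c ε (adamF α β₁ β₂ c ε z))^[k] y - x ε‖ ≤
            C * γ ^ k * ‖y - x ε‖ := by
  set G : ℝ → (Fin 3 → ℝ) → (Fin 3 → ℝ) :=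
    fun ε y => adamF α β₁ β₂ c ε (adamF α β₁ β₂ c ε y) with hGdef
  have hI : Set.Ioo (-δ) δ ∈ nhds (0 : ℝ) := Ioo_mem_nhds (neg_lt_zero.2 hδ) hδ
  have hx : ContDiffAt ℝ 1 x 0 := hxC1.contDiffAt hI
  have hG : ContDiffAt ℝ 1 (Function.uncurry G) (0, x 0) := by
    rw [hx0]
    exact contDiffAt_adamF_adamF_xF₁ hα hβ₁ hβ₂ hc
  have hD : ContinuousAt (fun ε => fderiv ℝ (G ε) (x ε)) 0 :=
    (hG.fderiv (m := 0) (hx.of_le zero_le_one) (by simp)).continuousAt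
  rw [← hx0] at hsr
  obtain ⟨n, hn⟩ := (matrixSpectralRadius_toMatrix'_lt_one_iff (fderiv ℝ (G 0) (x 0))).1 hsr
  have hpow : ∀ᶠ ε in nhds 0, ‖(fderiv ℝ (G ε) (x ε)) ^ (n + 1)‖ < 1 :=
    (hD.pow (n + 1)).norm.eventually_lt_const hn
  have hdiff : ∀ᶠ ε in nhds 0, ContDiffAt ℝ 1 (Function.uncurry G) (ε, x ε) :=
    (continuousAt_id.prodMk hx.continuousAt).eventually (hG.eventually (by simp))
  obtain ⟨δ', hδ', hball⟩ := Metric.eventually_nhds_iff.1 ((hpow.and hdiff).and hI)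
  refine ⟨δ', hδ', fun ε hε => ?_⟩
  obtain ⟨⟨hε1, hε2⟩, hε3⟩ := hball (y := ε) (by simpa [abs_lt] using hε)
  have hGε : DifferentiableAt ℝ (G ε) (x ε) :=
    (hε2.comp (x ε) (contDiffAt_const.prodMk contDiffAt_id)).differentiableAt one_ne_zero
  exact ⟨(matrixSpectralRadius_toMatrix'_lt_one_iff _).2 ⟨n, hε1⟩,
    hGε.hasFDerivAt.exists_norm_iterate_sub_le (hper ε hε3) hε1⟩
end
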